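/- For every τ in the upper half-plane ℍ and every z ∈ ℂ, both series below converge absolutely and ∑_{n≥0} r₂(n)·j₀(π² n z²)·e^{πinτ} = θ(τ)²·exp(A(τ)z²)·∑_{n≥0} π^{2n}·x(τ)^n·p_n(u(τ))·z^{2n}. (Here j₀(π² n z²) = J₀(2π√n·z), where J₀ is the Bessel function of order 0.) -/

import Mathlib

open Polynomial Complex Filter Topology

noncomputable section

/-- The theta constant `θ(τ) = ∑_{n ∈ ℤ} exp(πin²τ)`. -/
def theta (τ : ℂ) : ℂ := ∑' n : ℤ, Complex.exp (Real.pi * Complex.I * (n : ℂ) ^ 2 * τ)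

/-- `θ₂(τ) = ∑_{n ∈ ℤ} exp(πi(n+1/2)²τ)`. -/
def theta2 (τ : ℂ) : ℂ := ∑' n : ℤ, Complex.exp (Real.pi * Complex.I * ((n : ℂ) + 1/2) ^ 2 * τ)

/-- `θ₄(τ) = ∑_{n ∈ ℤ} (-1)ⁿ exp(πin²τ)`. -/
def theta4 (τ : ℂ) : ℂ :=
  ∑' n : ℤ, (-1 : ℂ) ^ n * Complex.exp (Real.pi * Complex.I * (n : ℂ) ^ 2 * τ)

/-- `x(τ) = -θ₄(τ)⁴`. -/
def xx (τ : ℂ) : ℂ := -(theta4 τ) ^ 4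

/-- `y(τ) = θ₂(τ)⁴`. -/
def yy (τ : ℂ) : ℂ := (theta2 τ) ^ 4

/-- The Hauptmodul `u(τ) = y(τ)/x(τ)`. -/
def uu (τ : ℂ) : ℂ := yy τ / xx τ

/-- `t(τ) = (1/(2πi)) θ'(τ)/θ(τ)`. -/
def tt (τ : ℂ) : ℂ := deriv theta τ / (2 * Real.pi * Complex.I * theta τ)

/-- `A(τ) = -4π² t(τ)`. -/
def AA (τ : ℂ) : ℂ := -4 * (Real.pi : ℂ) ^ 2 * tt τ

/-- `j₀(w) = ∑_{k≥0} (-1)^k w^k/(k!)²`, so that `j₀(π²nz²) = J₀(2π√n z)`. -/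
def j0 (w : ℂ) : ℂ := ∑' k : ℕ, (-1 : ℂ) ^ k * w ^ k / (Nat.factorial k : ℂ) ^ 2

/-- The number of representations of `n` as a sum of two squares of integers. -/
def r2 (n : ℕ) : ℕ := Set.ncard {p : ℤ × ℤ | p.1 ^ 2 + p.2 ^ 2 = (n : ℤ)}


/-! ## General exponential series -/

/-- Admissible data for a generalized Dirichlet-type exponential series. -/
def EAdm {ι : Type} (a : ι → ℂ) (l : ι → ℝ) : Prop :=
  (∀ i, 0 ≤ l i) ∧ ∀ y : ℝ, 0 < y → Summable fun i => ‖a i‖ * Real.exp (-(Real.pi * l i * y))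

/-- The exponential series. -/
def ES {ι : Type} (a : ι → ℂ) (l : ι → ℝ) (τ : ℂ) : ℂ :=
  ∑' i, a i * Complex.exp (Real.pi * Complex.I * (l i : ℂ) * τ)

lemma norm_eterm (a : ℂ) (l : ℝ) (τ : ℂ) :
    ‖a * Complex.exp (Real.pi * Complex.I * (l : ℂ) * τ)‖
      = ‖a‖ * Real.exp (-(Real.pi * l * τ.im)) := by
  rw [norm_mul, Complex.norm_exp]
  congr 2
  simp [Complex.mul_re, Complex.mul_im]

lemma EAdm.summable {ι : Type} {a : ι → ℂ} {l : ι → ℝ} (h : EAdm a l) {τ : ℂ} (hτ : 0 < τ.im) :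
    Summable fun i => ‖a i * Complex.exp (Real.pi * Complex.I * (l i : ℂ) * τ)‖ := by
  simp_rw [norm_eterm]
  exact h.2 _ hτ

lemma EAdm.deriv {ι : Type} {a : ι → ℂ} {l : ι → ℝ} (h : EAdm a l) :
    EAdm (fun i => a i * (l i : ℂ)) l := by
  refine ⟨h.1, fun y hy => ?_⟩
  have h1 := (h.2 (y / 2) (by positivity)).mul_left (2 / (Real.pi * y))
  refine Summable.of_nonneg_of_le (fun i => by positivity) (fun i => ?_) h1
  rw [norm_mul, Complex.norm_real, Real.norm_of_nonneg (h.1 i)]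
  have hpi := Real.pi_pos
  have hl := h.1 i
  have e1 : Real.pi * l i * y / 2 ≤ Real.exp (Real.pi * l i * y / 2) := by
    have := Real.add_one_le_exp (Real.pi * l i * y / 2)
    linarith
  have e2 : Real.exp (-(Real.pi * l i * (y / 2)))
      = Real.exp (Real.pi * l i * y / 2) * Real.exp (-(Real.pi * l i * y)) := by
    rw [← Real.exp_add]; congr 1; ring
  rw [e2]
  have e3 : l i ≤ 2 / (Real.pi * y) * Real.exp (Real.pi * l i * y / 2) := by
    rw [div_mul_eq_mul_div, le_div_iff₀ (by positivity)]
    linarith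
  calc ‖a i‖ * l i * Real.exp (-(Real.pi * l i * y))
      ≤ ‖a i‖ * (2 / (Real.pi * y) * Real.exp (Real.pi * l i * y / 2))
          * Real.exp (-(Real.pi * l i * y)) := by gcongr
    _ = _ := by ring

lemma EAdm.hasDerivAt {ι : Type} {a : ι → ℂ} {l : ι → ℝ} (h : EAdm a l) {τ : ℂ} (hτ : 0 < τ.im) :
    HasDerivAt (ES a l) (Real.pi * Complex.I * ES (fun i => a i * (l i : ℂ)) l τ) τ := by
  set U : Set ℂ := {w | τ.im / 2 < w.im} with hU
  have hUo : IsOpen U := isOpen_lt continuous_const Complex.continuous_im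
  have hτU : τ ∈ U := by simp only [hU, Set.mem_ofPred_eq]; linarith
  have hs := h.2 (τ.im / 2) (by positivity)
  have hd : ∀ i w, HasDerivAt (fun w => a i * Complex.exp (Real.pi * Complex.I * (l i : ℂ) * w))
      (Real.pi * Complex.I *
        (a i * (l i : ℂ) * Complex.exp (Real.pi * Complex.I * (l i : ℂ) * w))) w := by
    intro i w
    have h1 : HasDerivAt (fun w : ℂ => Real.pi * Complex.I * (l i : ℂ) * w)
        (Real.pi * Complex.I * (l i : ℂ) * 1) w := (hasDerivAt_id w).const_mul _
    have := h1.cexp.const_mul (a i)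
    convert! this using 1
    ring
  have hle : ∀ i w, w ∈ U → ‖a i * Complex.exp (Real.pi * Complex.I * (l i : ℂ) * w)‖
      ≤ ‖a i‖ * Real.exp (-(Real.pi * l i * (τ.im / 2))) := by
    intro i w hw
    rw [norm_eterm]
    have := h.1 i
    have hw' : τ.im / 2 ≤ w.im := le_of_lt hw
    gcongr
  have hdiff := Complex.differentiableOn_tsum_of_summable_norm hs
    (fun i w _ => (hd i w).differentiableAt.differentiableWithinAt) hUo hle
  have hsum := Complex.hasSum_deriv_of_summable_norm hs
    (fun i w _ => (hd i w).differentiableAt.differentiableWithinAt) hUo hle hτU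
  have := (hdiff.differentiableAt (hUo.mem_nhds hτU)).hasDerivAt
  convert! this using 1
  rw [← hsum.tsum_eq, ES, ← tsum_mul_left]
  congr 1; ext i
  rw [(hd i τ).deriv]

lemma EAdm.bound {ι : Type} {a : ι → ℂ} {l : ι → ℝ} (h : EAdm a l) (c : ℝ)
    (hc : ∀ i, a i = 0 ∨ c ≤ l i) :
    ∃ C : ℝ, ∀ τ : ℂ, 1 ≤ τ.im → ‖ES a l τ‖ ≤ C * Real.exp (-(Real.pi * c * τ.im)) := by
  have hpi := Real.pi_pos
  refine ⟨(∑' i, ‖a i‖ * Real.exp (-(Real.pi * l i * 1))) * Real.exp (Real.pi * c),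
    fun τ hτ => ?_⟩
  have h0 : 0 < τ.im := by linarith
  refine (norm_tsum_le_tsum_norm (h.summable h0)).trans ?_
  rw [mul_assoc, ← tsum_mul_right]
  refine (h.summable h0).tsum_le_tsum (fun i => ?_) ((h.2 1 one_pos).mul_right _)
  rw [norm_eterm]
  rcases hc i with h1 | h1
  · simp [h1]
  · rw [mul_assoc ‖a i‖]
    refine mul_le_mul_of_nonneg_left ?_ (norm_nonneg _)
    rw [← Real.exp_add, ← Real.exp_add]
    refine Real.exp_le_exp.2 ?_
    nlinarith [mul_nonneg (mul_nonneg hpi.le (sub_nonneg.2 h1)) (sub_nonneg.2 hτ)]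

lemma EAdm.tendsto {ι : Type} {a : ι → ℂ} {l : ι → ℝ} (h : EAdm a l) {s : ℕ → ℂ}
    (hs : Tendsto (fun n => (s n).im) atTop atTop) :
    Tendsto (fun n => ES a l (s n)) atTop (𝓝 (∑' i, if l i = 0 then a i else 0)) := by
  have hpi := Real.pi_pos
  refine tendsto_tsum_of_dominated_convergence (h.2 1 one_pos) (fun i => ?_) ?_
  · split_ifs with h0
    · simp [h0]
    · have hl : 0 < l i := lt_of_le_of_ne (h.1 i) (Ne.symm h0)
      rw [tendsto_zero_iff_norm_tendsto_zero]
      simp_rw [norm_eterm]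
      have : Tendsto (fun n => Real.pi * l i * (s n).im) atTop atTop :=
        hs.const_mul_atTop (by positivity)
      simpa using (Real.tendsto_exp_neg_atTop_nhds_zero.comp this).const_mul ‖a i‖
  · filter_upwards [hs.eventually_ge_atTop 1] with n hn i
    rw [norm_eterm]
    have := h.1 i
    gcongr

/-! ## Theta series as exponential series and the doubling formulas -/

lemma adm_sq_of_norm_one (a : ℤ → ℂ) (ha : ∀ n, ‖a n‖ = 1) : EAdm a (fun n : ℤ => (n : ℝ) ^ 2) := by
  refine ⟨fun n => sq_nonneg _, fun y hy => ?_⟩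
  have h := ((summable_jacobiTheta₂_term_iff 0 (y * Complex.I)).2 (by simpa using hy)).norm
  refine h.congr fun n => ?_
  rw [norm_jacobiTheta₂_term, ha]
  simp

lemma adm_g : EAdm (fun _ : ℤ => 1) (fun n : ℤ => (n : ℝ) ^ 2 + n) := by
  refine ⟨fun n => ?_, fun y hy => ?_⟩
  · have : 0 ≤ n ^ 2 + n := by
      rcases le_or_gt 0 n with h | h <;> nlinarith
    show (0 : ℝ) ≤ (n : ℝ) ^ 2 + n
    exact_mod_cast this
  have h := ((summable_jacobiTheta₂_term_iff (y / 2 * Complex.I) (y * Complex.I)).2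
    (by simpa using hy)).norm
  refine h.congr fun n => ?_
  rw [norm_jacobiTheta₂_term]
  simp
  ring

lemma adm_half_of_norm_one (a : ℤ → ℂ) (ha : ∀ n, ‖a n‖ = 1) :
    EAdm a (fun n : ℤ => ((n : ℝ) + 1 / 2) ^ 2) := by
  refine ⟨fun n => sq_nonneg _, fun y hy => ?_⟩
  refine ((adm_g.2 y hy).mul_right (Real.exp (-(Real.pi * (1 / 4) * y)))).congr fun n => ?_
  rw [ha, norm_one, one_mul, one_mul, ← Real.exp_add]
  congr 1; ring

lemma norm_neg_one_zpow' (n : ℤ) : ‖(-1 : ℂ) ^ n‖ = 1 := by simp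

lemma theta_eq : theta = ES (fun _ : ℤ => 1) (fun n : ℤ => (n : ℝ) ^ 2) := by
  ext τ; simp [theta, ES]

lemma theta4_eq : theta4 = ES (fun n : ℤ => (-1) ^ n) (fun n : ℤ => (n : ℝ) ^ 2) := by
  ext τ; simp [theta4, ES]

lemma theta2_eq : theta2 = ES (fun _ : ℤ => 1) (fun n : ℤ => ((n : ℝ) + 1 / 2) ^ 2) := by
  ext τ; simp [theta2, ES]

/-- The parity splitting of `ℤ × ℤ`. -/
def parEquiv : (ℤ × ℤ) ⊕ (ℤ × ℤ) ≃ ℤ × ℤ where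
  toFun := Sum.elim (fun p => (p.1 + p.2, p.1 - p.2)) (fun p => (p.1 + p.2 + 1, p.1 - p.2))
  invFun p := if (p.1 + p.2) % 2 = 0 then Sum.inl ((p.1 + p.2) / 2, (p.1 - p.2) / 2)
    else Sum.inr ((p.1 + p.2 - 1) / 2, (p.1 - p.2 - 1) / 2)
  left_inv := by
    rintro (⟨a, b⟩ | ⟨a, b⟩)
    · dsimp only [Sum.elim_inl]
      refine (if_pos (by omega)).trans ?_
      congr 2 <;> omega
    · dsimp only [Sum.elim_inr]
      refine (if_neg (by omega)).trans ?_
      congr 2 <;> omega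
  right_inv := by
    rintro ⟨m, n⟩
    dsimp only
    split_ifs with h
    · simp only [Sum.elim_inl]
      ext <;> dsimp only <;> omega
    · simp only [Sum.elim_inr]
      ext <;> dsimp only <;> omega

lemma tsum_mul_tsum_parity {f g : ℤ → ℂ} (hf : Summable fun n => ‖f n‖)
    (hg : Summable fun n => ‖g n‖) :
    (∑' n, f n) * ∑' n, g n = ∑' p : ℤ × ℤ, f (p.1 + p.2) * g (p.1 - p.2)
      + ∑' p : ℤ × ℤ, f (p.1 + p.2 + 1) * g (p.1 - p.2) := by
  rw [tsum_mul_tsum_of_summable_norm hf hg]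
  have hs : Summable fun p : ℤ × ℤ => f p.1 * g p.2 := summable_mul_of_summable_norm hf hg
  rw [← parEquiv.tsum_eq]
  have hs' := parEquiv.summable_iff.2 hs
  exact Summable.tsum_sum (hs'.comp_injective Sum.inl_injective)
    (hs'.comp_injective Sum.inr_injective)

lemma im_two_mul {τ : ℂ} (hτ : 0 < τ.im) : 0 < (2 * τ).im := by simpa using hτ

lemma summ3 {τ : ℂ} (hτ : 0 < τ.im) :
    Summable fun n : ℤ => ‖Complex.exp (Real.pi * Complex.I * (n : ℂ) ^ 2 * τ)‖ := by
  simpa using (adm_sq_of_norm_one (fun _ => 1) (by simp)).summable hτ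

lemma summ4 {τ : ℂ} (hτ : 0 < τ.im) :
    Summable fun n : ℤ => ‖(-1 : ℂ) ^ n * Complex.exp (Real.pi * Complex.I * (n : ℂ) ^ 2 * τ)‖ := by
  simpa using (adm_sq_of_norm_one (fun _ => 1) (by simp)).summable hτ

lemma summ2 {τ : ℂ} (hτ : 0 < τ.im) :
    Summable fun n : ℤ => ‖Complex.exp (Real.pi * Complex.I * ((n : ℂ) + 1 / 2) ^ 2 * τ)‖ := by
  simpa using (adm_half_of_norm_one (fun _ => 1) (by simp)).summable hτ

lemma summ1 {τ : ℂ} (hτ : 0 < τ.im) : Summable fun n : ℤ =>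
    ‖(-1 : ℂ) ^ n * Complex.exp (Real.pi * Complex.I * ((n : ℂ) + 1 / 2) ^ 2 * τ)‖ := by
  simpa using (adm_half_of_norm_one (fun _ => 1) (by simp)).summable hτ

lemma theta_sq {τ : ℂ} (hτ : 0 < τ.im) :
    theta τ ^ 2 = theta (2 * τ) ^ 2 + theta2 (2 * τ) ^ 2 := by
  have h2 := im_two_mul hτ
  rw [sq, sq, sq, theta, tsum_mul_tsum_parity (summ3 hτ) (summ3 hτ), theta, theta2,
    tsum_mul_tsum_of_summable_norm (summ3 h2) (summ3 h2),
    tsum_mul_tsum_of_summable_norm (summ2 h2) (summ2 h2)]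
  congr 1 <;>
  · congr 1; ext p
    rw [← Complex.exp_add, ← Complex.exp_add]
    congr 1; push_cast; ring

lemma neg_one_aux (a b : ℤ) : (-1 : ℂ) ^ (a + b) * (-1) ^ (a - b) = 1 := by
  rw [← zpow_add₀ (by norm_num)]
  exact Even.neg_one_zpow ⟨a, by ring⟩

lemma neg_one_aux' (a b : ℤ) : (-1 : ℂ) ^ (a + b + 1) * (-1) ^ (a - b) = -1 := by
  rw [← zpow_add₀ (by norm_num)]
  exact Odd.neg_one_zpow ⟨a, by ring⟩

lemma neg_one_aux'' (a b : ℤ) : (-1 : ℂ) ^ (a - b) = (-1) ^ a * (-1) ^ b := by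
  rw [zpow_sub₀ (by norm_num), div_eq_mul_inv, ← inv_zpow, inv_neg_one]

lemma theta4_sq {τ : ℂ} (hτ : 0 < τ.im) :
    theta4 τ ^ 2 = theta (2 * τ) ^ 2 - theta2 (2 * τ) ^ 2 := by
  have h2 := im_two_mul hτ
  rw [sq, sq, sq, theta4, tsum_mul_tsum_parity (summ4 hτ) (summ4 hτ), theta, theta2,
    tsum_mul_tsum_of_summable_norm (summ3 h2) (summ3 h2),
    tsum_mul_tsum_of_summable_norm (summ2 h2) (summ2 h2), sub_eq_add_neg, ← tsum_neg]
  congr 1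
  · congr 1; ext p
    rw [mul_mul_mul_comm, neg_one_aux, one_mul, ← Complex.exp_add, ← Complex.exp_add]
    congr 1; push_cast; ring
  · congr 1; ext p
    rw [mul_mul_mul_comm, neg_one_aux', neg_one_mul, ← Complex.exp_add, ← Complex.exp_add]
    congr 2; push_cast; ring

lemma theta1_zero (τ : ℂ) :
    ∑' n : ℤ, (-1 : ℂ) ^ n * Complex.exp (Real.pi * Complex.I * ((n : ℂ) + 1 / 2) ^ 2 * τ) = 0 := by
  rw [← self_eq_neg, ← tsum_neg]
  rw [← (Equiv.subLeft (-1 : ℤ)).tsum_eq]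
  congr 1; ext n
  simp only [Equiv.subLeft_apply]
  rw [neg_one_aux'', zpow_neg_one, inv_neg_one, neg_one_mul, neg_mul]
  congr 3; push_cast; ring

lemma theta_mul_theta4 {τ : ℂ} (hτ : 0 < τ.im) :
    theta τ * theta4 τ = theta4 (2 * τ) ^ 2 := by
  have h2 := im_two_mul hτ
  have hz : ∑' p : ℤ × ℤ, (Complex.exp (Real.pi * Complex.I * ((p.1 + p.2 + 1 : ℤ) : ℂ) ^ 2 * τ) *
      ((-1 : ℂ) ^ (p.1 - p.2) *
        Complex.exp (Real.pi * Complex.I * ((p.1 - p.2 : ℤ) : ℂ) ^ 2 * τ))) = 0 := by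
    rw [← mul_zero (0 : ℂ)]
    nth_rewrite 1 [← theta1_zero (2 * τ)]
    rw [← theta1_zero (2 * τ), tsum_mul_tsum_of_summable_norm (summ1 h2) (summ1 h2)]
    congr 1; ext p
    rw [mul_mul_mul_comm, neg_one_aux'', mul_left_comm, ← Complex.exp_add, ← Complex.exp_add]
    congr 2; push_cast; ring
  rw [sq, theta, theta4, tsum_mul_tsum_parity (summ3 hτ) (summ4 hτ), hz, add_zero, theta4,
    tsum_mul_tsum_of_summable_norm (summ4 h2) (summ4 h2)]
  congr 1; ext p
  rw [mul_mul_mul_comm, neg_one_aux'', mul_left_comm, ← Complex.exp_add, ← Complex.exp_add]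
  congr 2; push_cast; ring

lemma theta2_sq {τ : ℂ} (hτ : 0 < τ.im) :
    theta2 τ ^ 2 = 2 * theta (2 * τ) * theta2 (2 * τ) := by
  have h2 := im_two_mul hτ
  have e1 : ∑' p : ℤ × ℤ, (Complex.exp (Real.pi * Complex.I * (((p.1 + p.2 : ℤ) : ℂ) + 1 / 2) ^ 2 * τ)
      * Complex.exp (Real.pi * Complex.I * (((p.1 - p.2 : ℤ) : ℂ) + 1 / 2) ^ 2 * τ))
      = theta (2 * τ) * theta2 (2 * τ) := by
    rw [mul_comm (theta _), theta, theta2, tsum_mul_tsum_of_summable_norm (summ2 h2) (summ3 h2)]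
    congr 1; ext p
    rw [← Complex.exp_add, ← Complex.exp_add]
    congr 1; push_cast; ring
  have e2 : ∑' p : ℤ × ℤ,
      (Complex.exp (Real.pi * Complex.I * (((p.1 + p.2 + 1 : ℤ) : ℂ) + 1 / 2) ^ 2 * τ)
      * Complex.exp (Real.pi * Complex.I * (((p.1 - p.2 : ℤ) : ℂ) + 1 / 2) ^ 2 * τ))
      = theta (2 * τ) * theta2 (2 * τ) := by
    rw [theta, theta2, tsum_mul_tsum_of_summable_norm (summ3 h2) (summ2 h2)]
    conv_rhs => rw [← (Equiv.prodCongr (Equiv.addRight (1 : ℤ)) (Equiv.refl ℤ)).tsum_eq]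
    congr 1; ext p
    rw [← Complex.exp_add, ← Complex.exp_add]
    simp only [Equiv.prodCongr_apply, Prod.map, Equiv.coe_addRight, Equiv.refl_apply]
    congr 1; push_cast; ring
  rw [sq, theta2, tsum_mul_tsum_parity (summ2 hτ) (summ2 hτ), e1, e2]
  ring

/-! ## Derivatives, limits, nonvanishing -/

/-- derivative of `theta` -/
def dth (τ : ℂ) : ℂ :=
  Real.pi * Complex.I * ES (fun n : ℤ => 1 * (((n : ℝ) ^ 2 : ℝ) : ℂ)) (fun n : ℤ => (n : ℝ) ^ 2) τ

/-- second derivative of `theta` -/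
def ddth (τ : ℂ) : ℂ :=
  Real.pi * Complex.I * (Real.pi * Complex.I *
    ES (fun n : ℤ => 1 * (((n : ℝ) ^ 2 : ℝ) : ℂ) * (((n : ℝ) ^ 2 : ℝ) : ℂ))
      (fun n : ℤ => (n : ℝ) ^ 2) τ)

/-- derivative of `theta4` -/
def dth4 (τ : ℂ) : ℂ :=
  Real.pi * Complex.I * ES (fun n : ℤ => (-1) ^ n * (((n : ℝ) ^ 2 : ℝ) : ℂ))
    (fun n : ℤ => (n : ℝ) ^ 2) τ

/-- `theta2` without its leading power -/
def gg : ℂ → ℂ := ES (fun _ : ℤ => 1) (fun n : ℤ => (n : ℝ) ^ 2 + n)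

/-- derivative of `gg` -/
def dgg (τ : ℂ) : ℂ :=
  Real.pi * Complex.I * ES (fun n : ℤ => 1 * (((n : ℝ) ^ 2 + n : ℝ) : ℂ))
    (fun n : ℤ => (n : ℝ) ^ 2 + n) τ

/-- derivative of `theta2` -/
def dth2 (τ : ℂ) : ℂ :=
  Complex.exp (Real.pi * Complex.I / 4 * τ) * (Real.pi * Complex.I / 4 * gg τ + dgg τ)

lemma adm3 : EAdm (fun _ : ℤ => 1) (fun n : ℤ => (n : ℝ) ^ 2) :=
  adm_sq_of_norm_one _ (by simp)

lemma adm4 : EAdm (fun n : ℤ => (-1) ^ n) (fun n : ℤ => (n : ℝ) ^ 2) :=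
  adm_sq_of_norm_one _ (by simp)

lemma hasDerivAt_theta {τ : ℂ} (hτ : 0 < τ.im) : HasDerivAt theta (dth τ) τ := by
  rw [theta_eq]; exact adm3.hasDerivAt hτ

lemma hasDerivAt_dth {τ : ℂ} (hτ : 0 < τ.im) : HasDerivAt dth (ddth τ) τ :=
  (adm3.deriv.hasDerivAt hτ).const_mul _

lemma hasDerivAt_theta4 {τ : ℂ} (hτ : 0 < τ.im) : HasDerivAt theta4 (dth4 τ) τ := by
  rw [theta4_eq]; exact adm4.hasDerivAt hτ

lemma theta2_eq_gg (τ : ℂ) : theta2 τ = Complex.exp (Real.pi * Complex.I / 4 * τ) * gg τ := by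
  rw [gg, ES, theta2, ← tsum_mul_left]
  congr 1; ext n
  rw [one_mul, ← Complex.exp_add]
  congr 1; push_cast; ring

lemma hasDerivAt_theta2 {τ : ℂ} (hτ : 0 < τ.im) : HasDerivAt theta2 (dth2 τ) τ := by
  rw [show theta2 = fun τ => Complex.exp (Real.pi * Complex.I / 4 * τ) * gg τ from
    funext theta2_eq_gg]
  have h1 : HasDerivAt (fun w : ℂ => Real.pi * Complex.I / 4 * w)
        (Real.pi * Complex.I / 4 * 1) τ := (hasDerivAt_id τ).const_mul _
  have h2 : HasDerivAt gg (dgg τ) τ := adm_g.hasDerivAt hτ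
  convert! h1.cexp.mul h2 using 1
  rw [dth2]; ring

/-- the doubling sequence -/
def sq2 (τ : ℂ) (n : ℕ) : ℂ := 2 ^ n * τ

lemma sq2_im (τ : ℂ) (n : ℕ) : (sq2 τ n).im = 2 ^ n * τ.im := by
  rw [sq2, show ((2 : ℂ) ^ n) = ((2 ^ n : ℝ) : ℂ) by push_cast; rfl, Complex.im_ofReal_mul]

lemma sq2_im_pos {τ : ℂ} (hτ : 0 < τ.im) (n : ℕ) : 0 < (sq2 τ n).im := by
  rw [sq2_im]; positivity

lemma sq2_succ (τ : ℂ) (n : ℕ) : sq2 τ (n + 1) = 2 * sq2 τ n := by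
  rw [sq2, sq2, pow_succ]; ring

lemma tendsto_sq2_im {τ : ℂ} (hτ : 0 < τ.im) :
    Tendsto (fun n => (sq2 τ n).im) atTop atTop := by
  simp_rw [sq2_im]
  exact (tendsto_pow_atTop_atTop_of_one_lt (by norm_num)).atTop_mul_const hτ

lemma tendsto_theta {τ : ℂ} (hτ : 0 < τ.im) :
    Tendsto (fun n => theta (sq2 τ n)) atTop (𝓝 1) := by
  rw [theta_eq]
  convert! adm3.tendsto (tendsto_sq2_im hτ) using 2
  simp

lemma tendsto_theta4 {τ : ℂ} (hτ : 0 < τ.im) :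
    Tendsto (fun n => theta4 (sq2 τ n)) atTop (𝓝 1) := by
  rw [theta4_eq]
  convert! adm4.tendsto (tendsto_sq2_im hτ) using 2
  rw [tsum_eq_single 0]
  · simp
  · intro n hn; simp [hn]

lemma tendsto_dth {τ : ℂ} (hτ : 0 < τ.im) :
    Tendsto (fun n => dth (sq2 τ n)) atTop (𝓝 0) := by
  convert! (adm3.deriv.tendsto (tendsto_sq2_im hτ)).const_mul (Real.pi * Complex.I) using 2
  symm
  convert mul_zero _
  convert tsum_zero with n
  split_ifs with h
  · rw [h]; simp
  · rfl

lemma tendsto_gg {τ : ℂ} (hτ : 0 < τ.im) :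
    Tendsto (fun n => gg (sq2 τ n)) atTop (𝓝 2) := by
  convert! adm_g.tendsto (tendsto_sq2_im hτ) using 2
  rw [tsum_eq_sum (s := {0, -1})]
  · rw [Finset.sum_pair (by norm_num)]
    norm_num
  · intro n hn
    rw [if_neg]
    intro h
    have h' : n * (n + 1) = 0 := by
      have : (n : ℝ) * (n + 1) = 0 := by linarith
      exact_mod_cast this
    simp only [Finset.mem_insert, Finset.mem_singleton, not_or] at hn
    rcases mul_eq_zero.1 h' with h | h
    · exact hn.1 h
    · exact hn.2 (by omega)

lemma tendsto_dgg {τ : ℂ} (hτ : 0 < τ.im) :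
    Tendsto (fun n => dgg (sq2 τ n)) atTop (𝓝 0) := by
  convert! (adm_g.deriv.tendsto (tendsto_sq2_im hτ)).const_mul (Real.pi * Complex.I) using 2
  symm
  convert mul_zero _
  convert tsum_zero with n
  split_ifs with h
  · rw [h]; simp
  · rfl

lemma theta4_ne_zero {τ : ℂ} (hτ : 0 < τ.im) : theta4 τ ≠ 0 := by
  intro h
  have h1 : ∀ n, theta4 (sq2 τ n) = 0 := by
    intro n
    induction n with
    | zero => simpa [sq2] using h
    | succ n ih =>
      have := theta_mul_theta4 (sq2_im_pos hτ n)
      rw [ih, mul_zero, ← sq2_succ] at this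
      exact pow_eq_zero_iff two_ne_zero |>.1 this.symm
  have h2 := tendsto_theta4 hτ
  simp_rw [h1] at h2
  exact zero_ne_one (tendsto_nhds_unique tendsto_const_nhds h2)

lemma theta_ne_zero {τ : ℂ} (hτ : 0 < τ.im) : theta τ ≠ 0 := by
  intro h
  have := theta_mul_theta4 hτ
  rw [h, zero_mul] at this
  exact theta4_ne_zero (im_two_mul hτ) (pow_eq_zero_iff two_ne_zero |>.1 this.symm)

lemma theta2_ne_zero {τ : ℂ} (hτ : 0 < τ.im) : theta2 τ ≠ 0 := by
  intro h
  have h1 : ∀ n, theta2 (sq2 τ n) = 0 := by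
    intro n
    induction n with
    | zero => simpa [sq2] using h
    | succ n ih =>
      have := theta2_sq (sq2_im_pos hτ n)
      rw [ih, ← sq2_succ, eq_comm] at this
      simpa [theta_ne_zero (sq2_im_pos hτ (n + 1))] using this
  have h3 : ∀ n, gg (sq2 τ n) = 0 := by
    intro n
    have := h1 n
    rw [theta2_eq_gg] at this
    exact (mul_eq_zero.1 this).resolve_left (Complex.exp_ne_zero _)
  have h2 := tendsto_gg hτ
  simp_rw [h3] at h2
  exact two_ne_zero (tendsto_nhds_unique tendsto_const_nhds h2).symm

lemma uhp_mem_nhds {τ : ℂ} (hτ : 0 < τ.im) : ∀ᶠ w in 𝓝 τ, 0 < w.im :=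
  (isOpen_lt continuous_const Complex.continuous_im).mem_nhds hτ

lemma hasDerivAt_double {f : ℂ → ℂ} {f' : ℂ} {τ : ℂ} (h : HasDerivAt f f' (2 * τ)) :
    HasDerivAt (fun w => f (2 * w)) (2 * f') τ := by
  have h1 : HasDerivAt (fun w : ℂ => 2 * w) (2 * 1) τ := (hasDerivAt_id τ).const_mul _
  have := HasDerivAt.comp τ h h1
  convert! this using 1
  ring

lemma deriv_double3 {τ : ℂ} (hτ : 0 < τ.im) :
    theta τ * dth τ = 2 * (theta (2 * τ) * dth (2 * τ) + theta2 (2 * τ) * dth2 (2 * τ)) := by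
  have h2 := im_two_mul hτ
  have e1 := (hasDerivAt_theta hτ).pow 2
  have e2 := ((hasDerivAt_double (hasDerivAt_theta h2)).pow 2).add
    ((hasDerivAt_double (hasDerivAt_theta2 h2)).pow 2)
  have := e1.unique (e2.congr_of_eventuallyEq
    ((uhp_mem_nhds hτ).mono fun w hw => by simpa using theta_sq hw))
  linear_combination this / 2

lemma deriv_double4 {τ : ℂ} (hτ : 0 < τ.im) :
    theta4 τ * dth4 τ = 2 * (theta (2 * τ) * dth (2 * τ) - theta2 (2 * τ) * dth2 (2 * τ)) := by
  have h2 := im_two_mul hτ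
  have e1 := (hasDerivAt_theta4 hτ).pow 2
  have e2 := ((hasDerivAt_double (hasDerivAt_theta h2)).pow 2).sub
    ((hasDerivAt_double (hasDerivAt_theta2 h2)).pow 2)
  have := e1.unique (e2.congr_of_eventuallyEq
    ((uhp_mem_nhds hτ).mono fun w hw => by simpa using theta4_sq hw))
  linear_combination this / 2

lemma deriv_double2 {τ : ℂ} (hτ : 0 < τ.im) :
    theta2 τ * dth2 τ = 2 * (theta (2 * τ) * dth2 (2 * τ) + dth (2 * τ) * theta2 (2 * τ)) := by
  have h2 := im_two_mul hτ
  have e1 := (hasDerivAt_theta2 hτ).pow 2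
  have e2 := ((hasDerivAt_double (hasDerivAt_theta h2)).const_mul 2).mul
    (hasDerivAt_double (hasDerivAt_theta2 h2))
  have := e1.unique (e2.congr_of_eventuallyEq
    ((uhp_mem_nhds hτ).mono fun w hw => by simpa using theta2_sq hw))
  linear_combination this / 2

/-- logarithmic derivatives -/
def L3 (τ : ℂ) : ℂ := dth τ / theta τ
/-- logarithmic derivative of `theta2` -/
def L2 (τ : ℂ) : ℂ := dth2 τ / theta2 τ
/-- logarithmic derivative of `theta4` -/
def L4 (τ : ℂ) : ℂ := dth4 τ / theta4 τ

lemma dth_eq {τ : ℂ} (hτ : 0 < τ.im) : dth τ = theta τ * L3 τ := by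
  rw [L3, mul_div_cancel₀ _ (theta_ne_zero hτ)]
lemma dth2_eq {τ : ℂ} (hτ : 0 < τ.im) : dth2 τ = theta2 τ * L2 τ := by
  rw [L2, mul_div_cancel₀ _ (theta2_ne_zero hτ)]
lemma dth4_eq {τ : ℂ} (hτ : 0 < τ.im) : dth4 τ = theta4 τ * L4 τ := by
  rw [L4, mul_div_cancel₀ _ (theta4_ne_zero hτ)]

lemma theta4_double_four {τ : ℂ} (hτ : 0 < τ.im) : theta4 (2 * τ) ^ 4 =
    (theta (2 * τ) ^ 2 + theta2 (2 * τ) ^ 2) * (theta (2 * τ) ^ 2 - theta2 (2 * τ) ^ 2) := by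
  rw [← theta_sq hτ, ← theta4_sq hτ, ← mul_pow, theta_mul_theta4 hτ]; ring

lemma double_L3 {τ : ℂ} (hτ : 0 < τ.im) :
    (theta (2 * τ) ^ 2 + theta2 (2 * τ) ^ 2) * L3 τ
      = 2 * (theta (2 * τ) ^ 2 * L3 (2 * τ) + theta2 (2 * τ) ^ 2 * L2 (2 * τ)) := by
  have h2 := im_two_mul hτ
  have := deriv_double3 hτ
  rw [dth_eq hτ, dth_eq h2, dth2_eq h2] at this
  rw [← theta_sq hτ]
  linear_combination this

lemma double_L4 {τ : ℂ} (hτ : 0 < τ.im) :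
    (theta (2 * τ) ^ 2 - theta2 (2 * τ) ^ 2) * L4 τ
      = 2 * (theta (2 * τ) ^ 2 * L3 (2 * τ) - theta2 (2 * τ) ^ 2 * L2 (2 * τ)) := by
  have h2 := im_two_mul hτ
  have := deriv_double4 hτ
  rw [dth4_eq hτ, dth_eq h2, dth2_eq h2] at this
  rw [← theta4_sq hτ]
  linear_combination this

lemma double_L2 {τ : ℂ} (hτ : 0 < τ.im) : L2 τ = L3 (2 * τ) + L2 (2 * τ) := by
  have h2 := im_two_mul hτ
  have := deriv_double2 hτ
  rw [dth2_eq hτ, dth_eq h2, dth2_eq h2] at this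
  have h0 : theta2 τ ^ 2 ≠ 0 := pow_ne_zero _ (theta2_ne_zero hτ)
  apply mul_left_cancel₀ h0
  linear_combination this - (L3 (2 * τ) + L2 (2 * τ)) * theta2_sq hτ

/-- The invariant ratio. -/
def WW (τ : ℂ) : ℂ := (L2 τ - L3 τ) / theta4 τ ^ 4

lemma WW_double {τ : ℂ} (hτ : 0 < τ.im) : WW τ = WW (2 * τ) := by
  have h2 := im_two_mul hτ
  have n4 := pow_ne_zero 4 (theta4_ne_zero hτ)
  have n4' := pow_ne_zero 4 (theta4_ne_zero h2)
  rw [WW, WW, div_eq_div_iff n4 n4', theta4_double_four hτ,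
    show theta4 τ ^ 4 = (theta4 τ ^ 2) ^ 2 by ring, theta4_sq hτ, double_L2 hτ]
  linear_combination (-(theta (2 * τ) ^ 2 - theta2 (2 * τ) ^ 2)) * double_L3 hτ

lemma WW_eq {τ : ℂ} (hτ : 0 < τ.im) : WW τ = Real.pi * Complex.I / 4 := by
  have h1 : ∀ n, WW (sq2 τ n) = WW τ := by
    intro n
    induction n with
    | zero => simp [sq2]
    | succ n ih => rw [sq2_succ, ← WW_double (sq2_im_pos hτ n), ih]
  have h2 : Tendsto (fun n => WW (sq2 τ n)) atTop
      (𝓝 ((Real.pi * Complex.I / 4 + 0 / 2 - 0 / 1) / 1 ^ 4)) := by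
    have e : ∀ n, WW (sq2 τ n) = (Real.pi * Complex.I / 4 + dgg (sq2 τ n) / gg (sq2 τ n)
        - dth (sq2 τ n) / theta (sq2 τ n)) / theta4 (sq2 τ n) ^ 4 := by
      intro n
      have hn := theta2_ne_zero (sq2_im_pos hτ n)
      rw [theta2_eq_gg] at hn
      have hg := right_ne_zero_of_mul hn
      rw [WW, L2, L3, dth2, theta2_eq_gg, mul_div_mul_left _ _ (Complex.exp_ne_zero _), add_div,
        mul_div_cancel_right₀ _ hg]
    simp_rw [e]
    exact (((tendsto_dgg hτ).div (tendsto_gg hτ) two_ne_zero).const_add _ |>.sub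
      ((tendsto_dth hτ).div (tendsto_theta hτ) one_ne_zero)).div ((tendsto_theta4 hτ).pow 4)
      (by norm_num)
  simp_rw [h1] at h2
  simpa using tendsto_nhds_unique tendsto_const_nhds h2

lemma L2_sub_L3 {τ : ℂ} (hτ : 0 < τ.im) :
    L2 τ = L3 τ + Real.pi * Complex.I / 4 * theta4 τ ^ 4 := by
  have := WW_eq hτ
  rw [WW, div_eq_iff (pow_ne_zero 4 (theta4_ne_zero hτ))] at this
  linear_combination this

lemma L3_double {τ : ℂ} (hτ : 0 < τ.im) : L3 τ = 2 * L3 (2 * τ) + Real.pi * Complex.I / 2 *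
    (theta2 (2 * τ) ^ 2 * (theta (2 * τ) ^ 2 - theta2 (2 * τ) ^ 2)) := by
  have h2 := im_two_mul hτ
  have h0 : theta (2 * τ) ^ 2 + theta2 (2 * τ) ^ 2 ≠ 0 := by
    rw [← theta_sq hτ]; exact pow_ne_zero _ (theta_ne_zero hτ)
  apply mul_left_cancel₀ h0
  rw [double_L3 hτ, L2_sub_L3 h2, theta4_double_four hτ]
  ring

lemma L4_double {τ : ℂ} (hτ : 0 < τ.im) : L4 τ = 2 * L3 (2 * τ) - Real.pi * Complex.I / 2 *
    (theta2 (2 * τ) ^ 2 * (theta (2 * τ) ^ 2 + theta2 (2 * τ) ^ 2)) := by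
  have h2 := im_two_mul hτ
  have h0 : theta (2 * τ) ^ 2 - theta2 (2 * τ) ^ 2 ≠ 0 := by
    rw [← theta4_sq hτ]; exact pow_ne_zero _ (theta4_ne_zero hτ)
  apply mul_left_cancel₀ h0
  rw [double_L4 hτ, L2_sub_L3 h2, theta4_double_four hτ]
  ring

lemma L3_sub_L4 {τ : ℂ} (hτ : 0 < τ.im) :
    L4 τ = L3 τ - Real.pi * Complex.I / 4 * theta2 τ ^ 4 := by
  rw [L3_double hτ, L4_double hτ, show theta2 τ ^ 4 = (theta2 τ ^ 2) ^ 2 by ring, theta2_sq hτ]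
  ring

/-- derivative of `L3` -/
def dL3 (τ : ℂ) : ℂ := ddth τ / theta τ - L3 τ ^ 2

lemma hasDerivAt_L3 {τ : ℂ} (hτ : 0 < τ.im) : HasDerivAt L3 (dL3 τ) τ := by
  have h := (hasDerivAt_dth hτ).div (hasDerivAt_theta hτ) (theta_ne_zero hτ)
  convert! h using 1
  have := theta_ne_zero hτ
  rw [dL3, L3]
  field_simp

lemma dL3_double {τ : ℂ} (hτ : 0 < τ.im) : dL3 τ = 4 * dL3 (2 * τ) + Real.pi * Complex.I / 2 *
    (4 * theta2 (2 * τ) * dth2 (2 * τ) * (theta (2 * τ) ^ 2 - theta2 (2 * τ) ^ 2)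
      + theta2 (2 * τ) ^ 2 * (4 * theta (2 * τ) * dth (2 * τ)
        - 4 * theta2 (2 * τ) * dth2 (2 * τ))) := by
  have h2 := im_two_mul hτ
  have d3 := (hasDerivAt_double (hasDerivAt_theta h2)).pow 2
  have d2 := (hasDerivAt_double (hasDerivAt_theta2 h2)).pow 2
  have e2 := ((hasDerivAt_double (hasDerivAt_L3 h2)).const_mul 2).add
    ((d2.mul (d3.sub d2)).const_mul (Real.pi * Complex.I / 2))
  have := (hasDerivAt_L3 hτ).unique (e2.congr_of_eventuallyEq
    ((uhp_mem_nhds hτ).mono fun w hw => by simpa using L3_double hw))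
  rw [this]
  simp
  ring

/-- The deviation from the Riccati equation. -/
def KK (τ : ℂ) : ℂ := dL3 τ - 2 * L3 τ ^ 2 + Real.pi ^ 2 / 8 * theta2 τ ^ 4 * theta4 τ ^ 4

lemma KK_double {τ : ℂ} (hτ : 0 < τ.im) : KK τ = 4 * KK (2 * τ) := by
  have h2 := im_two_mul hτ
  rw [KK, KK, show theta2 τ ^ 4 = (theta2 τ ^ 2) ^ 2 by ring, theta2_sq hτ,
    show theta4 τ ^ 4 = (theta4 τ ^ 2) ^ 2 by ring, theta4_sq hτ, theta4_double_four hτ,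
    dL3_double hτ, L3_double hτ, dth_eq h2, dth2_eq h2, L2_sub_L3 h2, theta4_double_four hτ]
  ring_nf
  simp only [Complex.I_sq]
  ring

lemma tendsto_four_mul {f : ℂ → ℂ} {C : ℝ} {c : ℝ} (hc : 0 < c)
    (hf : ∀ τ : ℂ, 1 ≤ τ.im → ‖f τ‖ ≤ C * Real.exp (-(Real.pi * c * τ.im)))
    {τ : ℂ} (hτ : 0 < τ.im) :
    Tendsto (fun n : ℕ => (4 : ℂ) ^ n * f (sq2 τ n)) atTop (𝓝 0) := by
  have hpi := Real.pi_pos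
  have h1 : Tendsto (fun y : ℝ => y ^ 2 * Real.exp (-(Real.pi * c) * y)) atTop (𝓝 0) := by
    have := Real.tendsto_pow_mul_exp_neg_atTop_nhds_zero 2
    have h3 : Tendsto (fun y : ℝ => (Real.pi * c) * y) atTop atTop :=
      tendsto_id.const_mul_atTop (by positivity)
    have h4 := (this.comp h3).const_mul ((Real.pi * c) ^ 2)⁻¹
    rw [mul_zero] at h4
    refine h4.congr fun y => ?_
    simp only [Function.comp]
    rw [neg_mul]
    field_simp
  have h5 := ((h1.comp (tendsto_sq2_im hτ)).const_mul C).const_mul (τ.im ^ 2)⁻¹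
  rw [mul_zero, mul_zero] at h5
  refine squeeze_zero_norm' ?_ h5
  filter_upwards [(tendsto_sq2_im hτ).eventually_ge_atTop 1] with n hn
  rw [norm_mul, norm_pow]
  have h6 := hf _ hn
  simp only [Function.comp]
  have h7 : ‖(4 : ℂ)‖ = 4 := by simp
  rw [h7]
  calc (4 : ℝ) ^ n * ‖f (sq2 τ n)‖
      ≤ 4 ^ n * (C * Real.exp (-(Real.pi * c * (sq2 τ n).im))) := by gcongr
    _ = _ := by
      rw [neg_mul]
      rw [show (sq2 τ n).im ^ 2 = 4 ^ n * τ.im ^ 2 by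
        rw [sq2_im, mul_pow, ← pow_mul, mul_comm n 2, pow_mul]; norm_num]
      field_simp

lemma KK_eq {τ : ℂ} (hτ : 0 < τ.im) : KK τ = 0 := by
  have h1 : ∀ n, (4 : ℂ) ^ n * KK (sq2 τ n) = KK τ := by
    intro n
    induction n with
    | zero => simp [sq2]
    | succ n ih =>
      rw [← ih, KK_double (sq2_im_pos hτ n), sq2_succ]; ring
  have hl : ∀ n : ℤ, ∀ a : ℂ, a * (((n : ℝ) ^ 2 : ℝ) : ℂ) = 0 ∨ (1 : ℝ) ≤ (n : ℝ) ^ 2 := by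
    intro n a
    rcases eq_or_ne n 0 with h | h
    · left; simp [h]
    · right
      have : 1 ≤ n ^ 2 := by have := sq_nonneg n; have := pow_ne_zero 2 h; omega
      exact_mod_cast this
  have t1 : Tendsto (fun n : ℕ => (4 : ℂ) ^ n * ddth (sq2 τ n)) atTop (𝓝 0) := by
    obtain ⟨C, hC⟩ := adm3.deriv.deriv.bound 1 (fun n => hl n _)
    have := (tendsto_four_mul one_pos hC hτ).const_mul
      ((Real.pi : ℂ) * Complex.I * (Real.pi * Complex.I))
    rw [mul_zero] at this
    refine this.congr fun n => ?_
    rw [ddth]; ring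
  have t2 : Tendsto (fun n : ℕ => (4 : ℂ) ^ n * dth (sq2 τ n)) atTop (𝓝 0) := by
    obtain ⟨C, hC⟩ := adm3.deriv.bound 1 (fun n => hl n _)
    have := (tendsto_four_mul one_pos hC hτ).const_mul ((Real.pi : ℂ) * Complex.I)
    rw [mul_zero] at this
    refine this.congr fun n => ?_
    rw [dth]; ring
  have t3 : Tendsto (fun n : ℕ => (4 : ℂ) ^ n * theta2 (sq2 τ n)) atTop (𝓝 0) := by
    have hl2 : ∀ n : ℤ, (1 : ℂ) = 0 ∨ (1 / 4 : ℝ) ≤ ((n : ℝ) + 1 / 2) ^ 2 := by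
      intro n; right
      have := adm_g.1 n
      dsimp only at this
      linarith
    obtain ⟨C, hC⟩ := (adm_half_of_norm_one (fun _ => 1) (by simp)).bound (1 / 4) hl2
    rw [theta2_eq]
    exact tendsto_four_mul (by norm_num) hC hτ
  have t4 : Tendsto (fun n : ℕ => theta2 (sq2 τ n)) atTop (𝓝 0) := by
    refine squeeze_zero_norm (fun n => ?_) (tendsto_zero_iff_norm_tendsto_zero.1 t3)
    rw [norm_mul, norm_pow, show ‖(4 : ℂ)‖ = 4 by simp]
    exact le_mul_of_one_le_left (norm_nonneg _) (one_le_pow₀ (by norm_num))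
  have h2 := (((t1.div (tendsto_theta hτ) one_ne_zero).sub
    ((t2.mul (tendsto_dth hτ)).const_mul 3 |>.div ((tendsto_theta hτ).pow 2) (by norm_num))).add
    ((t3.mul ((t4.pow 3).mul ((tendsto_theta4 hτ).pow 4))).const_mul ((Real.pi : ℂ) ^ 2 / 8)))
  have h3 : Tendsto (fun n : ℕ => (4 : ℂ) ^ n * KK (sq2 τ n)) atTop (𝓝 0) := by
    simp only [mul_zero, zero_mul, zero_div, sub_zero, add_zero] at h2
    refine h2.congr fun n => ?_
    have := theta_ne_zero (sq2_im_pos hτ n)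
    simp only [Pi.div_apply]
    rw [KK, dL3, L3]
    field_simp
    ring
  simp_rw [h1] at h3
  exact tendsto_nhds_unique tendsto_const_nhds h3

lemma dL3_eq {τ : ℂ} (hτ : 0 < τ.im) :
    dL3 τ = 2 * L3 τ ^ 2 - Real.pi ^ 2 / 8 * theta2 τ ^ 4 * theta4 τ ^ 4 := by
  have := KK_eq hτ
  rw [KK] at this
  linear_combination this

/-! ## The series `∑ r₂(n) n^k e^{πinτ}` -/

lemma hasSum_r2 {τ : ℂ} (hτ : 0 < τ.im) :
    HasSum (fun n : ℕ => (r2 n : ℂ) * Complex.exp (Real.pi * Complex.I * (n : ℂ) * τ))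
      (theta τ ^ 2) := by
  have h1 : HasSum (fun p : ℤ × ℤ => Complex.exp (Real.pi * Complex.I * (p.1 : ℂ) ^ 2 * τ) *
      Complex.exp (Real.pi * Complex.I * (p.2 : ℂ) ^ 2 * τ)) (theta τ ^ 2) := by
    rw [sq, theta, tsum_mul_tsum_of_summable_norm (summ3 hτ) (summ3 hτ)]
    exact (summable_mul_of_summable_norm (summ3 hτ) (summ3 hτ)).hasSum
  have h2 := h1.tsum_fiberwise (fun p : ℤ × ℤ => (p.1 ^ 2 + p.2 ^ 2).toNat)
  convert! h2 using 1
  ext n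
  have h3 : (fun p : ℤ × ℤ => (p.1 ^ 2 + p.2 ^ 2).toNat) ⁻¹' {n}
      = {p : ℤ × ℤ | p.1 ^ 2 + p.2 ^ 2 = (n : ℤ)} := by
    ext p
    simp only [Set.mem_preimage, Set.mem_singleton_iff, Set.mem_ofPred_eq]
    have : 0 ≤ p.1 ^ 2 + p.2 ^ 2 := by positivity
    omega
  rw [h3]
  have h4 : ∀ b : {p : ℤ × ℤ | p.1 ^ 2 + p.2 ^ 2 = (n : ℤ)},
      Complex.exp (Real.pi * Complex.I * ((b : ℤ × ℤ).1 : ℂ) ^ 2 * τ) *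
      Complex.exp (Real.pi * Complex.I * ((b : ℤ × ℤ).2 : ℂ) ^ 2 * τ)
      = Complex.exp (Real.pi * Complex.I * (n : ℂ) * τ) := by
    rintro ⟨p, hp⟩
    have hp' : ((p.1 : ℂ)) ^ 2 + (p.2 : ℂ) ^ 2 = n := by
      have : p.1 ^ 2 + p.2 ^ 2 = (n : ℤ) := hp
      exact_mod_cast this
    rw [← Complex.exp_add, ← hp']
    congr 1; ring
  rw [tsum_congr h4, tsum_const, r2, ← nsmul_eq_mul, Nat.card_coe_set_eq]

lemma adm_r2 : EAdm (fun n : ℕ => (r2 n : ℂ)) (fun n : ℕ => (n : ℝ)) := by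
  refine ⟨fun n => Nat.cast_nonneg n, fun y hy => ?_⟩
  have h : 0 < ((y : ℂ) * Complex.I).im := by simpa using hy
  refine (hasSum_r2 h).summable.norm.congr fun n => ?_
  have := norm_eterm (r2 n : ℂ) (n : ℝ) (y * Complex.I)
  simp only [Complex.ofReal_natCast] at this
  rw [this]
  simp

/-- The moment series. -/
def SS : ℕ → ℂ → ℂ := fun k =>
  ES (fun n : ℕ => (r2 n : ℂ) * (n : ℂ) ^ k) (fun n : ℕ => (n : ℝ))

lemma adm_SS (k : ℕ) : EAdm (fun n : ℕ => (r2 n : ℂ) * (n : ℂ) ^ k) (fun n : ℕ => (n : ℝ)) := by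
  induction k with
  | zero => simpa using adm_r2
  | succ k ih =>
    convert! ih.deriv using 2
    push_cast; ring

lemma hasDerivAt_SS (k : ℕ) {τ : ℂ} (hτ : 0 < τ.im) :
    HasDerivAt (SS k) (Real.pi * Complex.I * SS (k + 1) τ) τ := by
  convert! (adm_SS k).hasDerivAt hτ using 2
  rw [SS, ES, ES]
  congr 1; ext n
  push_cast; ring

lemma SS_zero {τ : ℂ} (hτ : 0 < τ.im) : SS 0 τ = theta τ ^ 2 := by
  rw [← (hasSum_r2 hτ).tsum_eq, SS, ES]
  congr 1; ext n
  simp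

/-! ## The recurrence -/

lemma deriv_theta_eq {τ : ℂ} (hτ : 0 < τ.im) : deriv theta τ = dth τ :=
  (hasDerivAt_theta hτ).deriv

lemma AA_eq {τ : ℂ} (hτ : 0 < τ.im) : AA τ = 2 * Real.pi * Complex.I * L3 τ := by
  have h0 := theta_ne_zero hτ
  have hpi : (Real.pi : ℂ) ≠ 0 := Complex.ofReal_ne_zero.2 Real.pi_ne_zero
  have hI := Complex.I_ne_zero
  rw [AA, tt, deriv_theta_eq hτ, L3]
  field_simp
  linear_combination (-4 * dth τ) * Complex.I_sq

lemma xx_ne_zero {τ : ℂ} (hτ : 0 < τ.im) : xx τ ≠ 0 :=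
  neg_ne_zero.2 (pow_ne_zero _ (theta4_ne_zero hτ))

lemma yy_eq {τ : ℂ} (hτ : 0 < τ.im) : yy τ = uu τ * xx τ := by
  rw [uu, div_mul_cancel₀ _ (xx_ne_zero hτ)]

lemma hasDerivAt_xx {τ : ℂ} (hτ : 0 < τ.im) :
    HasDerivAt xx (xx τ * (4 * L3 τ - Real.pi * Complex.I * uu τ * xx τ)) τ := by
  have h : HasDerivAt xx _ τ := ((hasDerivAt_theta4 hτ).pow 4).neg
  convert! h using 1
  have h4 := L3_sub_L4 hτ
  have hy := yy_eq hτ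
  have hx : xx τ = -(theta4 τ) ^ 4 := rfl
  rw [dth4_eq hτ, h4, mul_assoc _ (uu τ), ← hy, hx, yy]
  push_cast
  ring

lemma hasDerivAt_yy {τ : ℂ} (hτ : 0 < τ.im) :
    HasDerivAt yy (yy τ * (4 * L3 τ - Real.pi * Complex.I * xx τ)) τ := by
  have h : HasDerivAt yy _ τ := ((hasDerivAt_theta2 hτ).pow 4)
  convert! h using 1
  rw [dth2_eq hτ, L2_sub_L3 hτ, yy, xx]
  push_cast
  ring

lemma hasDerivAt_uu {τ : ℂ} (hτ : 0 < τ.im) :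
    HasDerivAt uu (Real.pi * Complex.I * xx τ * (uu τ ^ 2 - uu τ)) τ := by
  have h : HasDerivAt uu _ τ := (hasDerivAt_yy hτ).div (hasDerivAt_xx hτ) (xx_ne_zero hτ)
  convert! h using 1
  have h0 := xx_ne_zero hτ
  rw [yy_eq hτ]
  field_simp
  ring

lemma hasDerivAt_AA {τ : ℂ} (hτ : 0 < τ.im) :
    HasDerivAt AA (2 * Real.pi * Complex.I *
      (2 * L3 τ ^ 2 + Real.pi ^ 2 / 8 * uu τ * xx τ ^ 2)) τ := by
  have h := (hasDerivAt_L3 hτ).const_mul (2 * Real.pi * Complex.I)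
  have h' := h.congr_of_eventuallyEq ((uhp_mem_nhds hτ).mono fun w hw => AA_eq hw)
  convert! h' using 1
  rw [dL3_eq hτ]
  have hy : theta2 τ ^ 4 = uu τ * xx τ := yy_eq hτ
  have hx : theta4 τ ^ 4 = - xx τ := by rw [xx, neg_neg]
  rw [hy, hx]; ring

/-- The coefficients of the right-hand series. -/
def bb (p : ℕ → Polynomial ℚ) (n : ℕ) (τ : ℂ) : ℂ :=
  (Real.pi : ℂ) ^ (2 * n) * (xx τ) ^ n * Polynomial.aeval (uu τ) (p n)

/-- The derivatives of the coefficients of the right-hand series. -/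
def dbb (p : ℕ → Polynomial ℚ) (n : ℕ) (τ : ℂ) : ℂ :=
  (Real.pi : ℂ) ^ (2 * n) * (xx τ) ^ n *
    ((n : ℂ) * (4 * L3 τ - Real.pi * Complex.I * uu τ * xx τ) * Polynomial.aeval (uu τ) (p n)
      + Real.pi * Complex.I * xx τ * (uu τ ^ 2 - uu τ) *
        Polynomial.aeval (uu τ) (Polynomial.derivative (p n)))

lemma hasDerivAt_bb (p : ℕ → Polynomial ℚ) (n : ℕ) {τ : ℂ} (hτ : 0 < τ.im) :
    HasDerivAt (bb p n) (dbb p n τ) τ := by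
  have h1 := ((hasDerivAt_xx hτ).pow n).const_mul ((Real.pi : ℂ) ^ (2 * n))
  have h2 := ((p n).hasDerivAt_aeval (uu τ)).comp τ (hasDerivAt_uu hτ)
  have h : HasDerivAt (bb p n) _ τ := h1.mul h2
  convert! h using 1
  rw [dbb]
  simp only [Function.comp, Pi.pow_apply]
  rcases n with _ | n
  · simp; ring
  · rw [Nat.add_sub_cancel, pow_succ (xx τ)]; ring

lemma bb_rec (p : ℕ → Polynomial ℚ)
    (hprec : ∀ n : ℕ,
      (((n : ℚ) + 1) ^ 2) • p (n + 1) + (X ^ 2 - X) * Polynomial.derivative (p n)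
        - (n : ℚ) • (X * p n)
        + (1/4 : ℚ) • (X * (if n = 0 then 0 else p (n - 1))) = 0)
    (n : ℕ) (τ : ℂ) :
    ((n : ℂ) + 1) ^ 2 * bb p (n + 1) τ + 4 * Real.pi * Complex.I * L3 τ * n * bb p n τ
      + Real.pi ^ 4 / 4 * uu τ * xx τ ^ 2 * (if n = 0 then 0 else bb p (n - 1) τ)
      = Real.pi * Complex.I * dbb p n τ := by
  have h := congrArg (Polynomial.aeval (uu τ)) (hprec n)
  simp only [map_add, map_sub, map_smul, map_mul, map_pow, Polynomial.aeval_X, map_zero,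
    Algebra.smul_def] at h
  have c1 : (algebraMap ℚ ℂ) (((n : ℚ) + 1) ^ 2) = ((n : ℂ) + 1) ^ 2 := by simp
  have c2 : (algebraMap ℚ ℂ) (n : ℚ) = (n : ℂ) := by simp
  have c3 : (Polynomial.aeval (uu τ)) (algebraMap ℚ ℚ[X] (1 / 4)) = (1 / 4 : ℂ) := by
    rw [AlgHom.commutes]; simp
  simp only [map_natCast, map_one] at h
  rw [c3] at h
  rcases n with _ | n
  · simp only [if_true, bb, dbb] at h ⊢
    simp at h ⊢
    linear_combination (Real.pi : ℂ) ^ 2 * xx τ * h -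
      Real.pi ^ 2 * xx τ * (uu τ ^ 2 - uu τ) *
        Polynomial.aeval (uu τ) (Polynomial.derivative (p 0)) * Complex.I_sq
  · rw [if_neg (Nat.succ_ne_zero n)] at h ⊢
    rw [Nat.add_sub_cancel] at h ⊢
    simp only [bb, dbb]
    push_cast at h ⊢
    have e1 : (Real.pi : ℂ) ^ (2 * (n + 1 + 1)) = Real.pi ^ (2 * n) * Real.pi ^ 4 := by ring
    have e2 : (Real.pi : ℂ) ^ (2 * (n + 1)) = Real.pi ^ (2 * n) * Real.pi ^ 2 := by ring
    rw [e1, e2, pow_succ (xx τ) (n + 1), pow_succ (xx τ) n]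
    linear_combination (Real.pi : ℂ) ^ (2 * n) * Real.pi ^ 4 * xx τ ^ n * xx τ ^ 2 * h -
      (Real.pi : ℂ) ^ (2 * n) * Real.pi ^ 4 * xx τ ^ n * xx τ ^ 2 * ((uu τ ^ 2 - uu τ) *
        Polynomial.aeval (uu τ) (Polynomial.derivative (p (n + 1))) -
        ((n : ℂ) + 1) * uu τ * Polynomial.aeval (uu τ) (p (n + 1))) * Complex.I_sq

/-! ## Formal power series -/

/-- The formal exponential series `exp(aX)`. -/
def Eser (a : ℂ) : PowerSeries ℂ := PowerSeries.rescale a (PowerSeries.exp ℂ)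

lemma coeff_Eser (a : ℂ) (n : ℕ) : PowerSeries.coeff n (Eser a) = a ^ n / (n.factorial : ℂ) := by
  simp [Eser, PowerSeries.coeff_rescale, PowerSeries.coeff_exp, div_eq_mul_inv]

lemma Eser_mul_neg (a : ℂ) : Eser a * Eser (-a) = 1 := by
  rw [Eser, Eser, PowerSeries.exp_mul_exp_eq_exp_add]
  ext n
  rw [← Eser, coeff_Eser, add_neg_cancel, PowerSeries.coeff_one]
  split_ifs with h
  · simp [h]
  · simp [h]

lemma deriv_Eser (a : ℂ) :
    PowerSeries.derivative ℂ (Eser a) = PowerSeries.C a * Eser a := by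
  ext n
  rw [PowerSeries.coeff_derivative, PowerSeries.coeff_C_mul, coeff_Eser, coeff_Eser,
    Nat.factorial_succ]
  push_cast
  have h1 : (n.factorial : ℂ) ≠ 0 := Nat.cast_ne_zero.2 (Nat.factorial_ne_zero n)
  have h2 : (n : ℂ) + 1 ≠ 0 := Nat.cast_add_one_ne_zero n
  field_simp
  ring

/-- The formal series of the coefficients. -/
def Bser (p : ℕ → Polynomial ℚ) (τ : ℂ) : PowerSeries ℂ := PowerSeries.mk fun n => bb p n τ

/-- The formal series of the derivatives of the coefficients. -/
def dBser (p : ℕ → Polynomial ℚ) (τ : ℂ) : PowerSeries ℂ := PowerSeries.mk fun n => dbb p n τ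

/-- The product series. -/
def Cser (p : ℕ → Polynomial ℚ) (τ : ℂ) : PowerSeries ℂ :=
  PowerSeries.C (theta τ ^ 2) * (Eser (AA τ) * Bser p τ)

/-- The derivative of the product series. -/
def dCser (p : ℕ → Polynomial ℚ) (τ : ℂ) : PowerSeries ℂ :=
  PowerSeries.C (2 * theta τ ^ 2 * L3 τ) * (Eser (AA τ) * Bser p τ)
  + PowerSeries.C (theta τ ^ 2) *
    (PowerSeries.C (2 * Real.pi * Complex.I *
      (2 * L3 τ ^ 2 + Real.pi ^ 2 / 8 * uu τ * xx τ ^ 2)) * (PowerSeries.X * Eser (AA τ)) * Bser p τ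
      + Eser (AA τ) * dBser p τ)

lemma hasDerivAt_Cser (p : ℕ → Polynomial ℚ) (n : ℕ) {τ : ℂ} (hτ : 0 < τ.im) :
    HasDerivAt (fun w => PowerSeries.coeff n (Cser p w)) (PowerSeries.coeff n (dCser p τ)) τ := by
  set A' := 2 * Real.pi * Complex.I *
      (2 * L3 τ ^ 2 + Real.pi ^ 2 / 8 * uu τ * xx τ ^ 2) with hA'
  have hF : HasDerivAt (fun w => theta w ^ 2) (2 * theta τ ^ 2 * L3 τ) τ := by
    have h := (hasDerivAt_theta hτ).pow 2
    convert! h using 1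
    rw [dth_eq hτ]; push_cast; ring
  have hE : ∀ i : ℕ, HasDerivAt (fun w => PowerSeries.coeff i (Eser (AA w)))
      (PowerSeries.coeff i (PowerSeries.C A' * (PowerSeries.X * Eser (AA τ)))) τ := by
    intro i
    simp_rw [coeff_Eser]
    have h := ((hasDerivAt_AA hτ).pow i).div_const (i.factorial : ℂ)
    convert! h using 1
    rw [PowerSeries.coeff_C_mul]
    rcases i with _ | i
    · simp
    · rw [PowerSeries.coeff_succ_X_mul, coeff_Eser, Nat.add_sub_cancel, Nat.factorial_succ]
      push_cast
      have h1 : (i.factorial : ℂ) ≠ 0 := Nat.cast_ne_zero.2 (Nat.factorial_ne_zero i)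
      have h2 : (i : ℂ) + 1 ≠ 0 := Nat.cast_add_one_ne_zero i
      rw [hA']
      field_simp
  have hB : ∀ i : ℕ, HasDerivAt (fun w => PowerSeries.coeff i (Bser p w))
      (PowerSeries.coeff i (dBser p τ)) τ := by
    intro i
    simp only [Bser, dBser, PowerSeries.coeff_mk]
    exact hasDerivAt_bb p i hτ
  have hEB : HasDerivAt (fun w => PowerSeries.coeff n (Eser (AA w) * Bser p w))
      (PowerSeries.coeff n (PowerSeries.C A' * (PowerSeries.X * Eser (AA τ)) * Bser p τ
        + Eser (AA τ) * dBser p τ)) τ := by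
    rw [map_add, PowerSeries.coeff_mul, PowerSeries.coeff_mul, ← Finset.sum_add_distrib]
    simp_rw [PowerSeries.coeff_mul n (Eser _) (Bser p _)]
    exact HasDerivAt.fun_sum fun ij _ => (hE ij.1).mul (hB ij.2)
  simp only [Cser, dCser, map_add, PowerSeries.coeff_C_mul] at hEB ⊢
  exact hF.mul hEB

lemma Bser_rec (p : ℕ → Polynomial ℚ)
    (hprec : ∀ n : ℕ,
      (((n : ℚ) + 1) ^ 2) • p (n + 1) + (X ^ 2 - X) * Polynomial.derivative (p n)
        - (n : ℚ) • (X * p n)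
        + (1/4 : ℚ) • (X * (if n = 0 then 0 else p (n - 1))) = 0)
    {τ : ℂ} (hτ : 0 < τ.im) :
    PowerSeries.derivative ℂ (PowerSeries.X * PowerSeries.derivative ℂ (Bser p τ))
      + PowerSeries.C (2 * AA τ) * (PowerSeries.X * PowerSeries.derivative ℂ (Bser p τ))
      + PowerSeries.C (Real.pi ^ 4 / 4 * uu τ * xx τ ^ 2) * (PowerSeries.X * Bser p τ)
      = PowerSeries.C (Real.pi * Complex.I) * dBser p τ := by
  ext n
  have h := bb_rec p hprec n τ
  rw [map_add, map_add, PowerSeries.coeff_C_mul, PowerSeries.coeff_C_mul, PowerSeries.coeff_C_mul,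
    PowerSeries.coeff_derivative, PowerSeries.coeff_succ_X_mul, PowerSeries.coeff_derivative,
    dBser, PowerSeries.coeff_mk, ← h, AA_eq hτ, Bser, PowerSeries.coeff_mk]
  rcases n with _ | n
  · simp
  · rw [PowerSeries.coeff_succ_X_mul, PowerSeries.coeff_succ_X_mul, PowerSeries.coeff_derivative,
      PowerSeries.coeff_mk, PowerSeries.coeff_mk, if_neg (Nat.succ_ne_zero n), Nat.add_sub_cancel]
    push_cast
    ring

lemma Cser_rec (p : ℕ → Polynomial ℚ)
    (hprec : ∀ n : ℕ,
      (((n : ℚ) + 1) ^ 2) • p (n + 1) + (X ^ 2 - X) * Polynomial.derivative (p n)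
        - (n : ℚ) • (X * p n)
        + (1/4 : ℚ) • (X * (if n = 0 then 0 else p (n - 1))) = 0)
    {τ : ℂ} (hτ : 0 < τ.im) :
    PowerSeries.derivative ℂ (PowerSeries.X * PowerSeries.derivative ℂ (Cser p τ))
      = PowerSeries.C (Real.pi * Complex.I) * dCser p τ := by
  have h := Bser_rec p hprec hτ
  have hdX : PowerSeries.derivative ℂ (PowerSeries.X : PowerSeries ℂ) = 1 := by
    simp
  have hdC : ∀ a : ℂ, PowerSeries.derivative ℂ (PowerSeries.C a) = 0 := by
    intro a; simp
  have r1 : PowerSeries.C (Real.pi * Complex.I) * PowerSeries.C (2 * theta τ ^ 2 * L3 τ)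
      = PowerSeries.C (theta τ ^ 2) * PowerSeries.C (AA τ) := by
    rw [← map_mul, ← map_mul, AA_eq hτ]; congr 1; ring
  have r2 : PowerSeries.C (Real.pi * Complex.I) * PowerSeries.C (2 * Real.pi * Complex.I *
      (2 * L3 τ ^ 2 + Real.pi ^ 2 / 8 * uu τ * xx τ ^ 2))
      = PowerSeries.C (AA τ) ^ 2 - PowerSeries.C (Real.pi ^ 4 / 4 * uu τ * xx τ ^ 2) := by
    rw [← map_mul, ← map_pow, ← map_sub, AA_eq hτ]; congr 1
    linear_combination Real.pi ^ 4 / 4 * uu τ * xx τ ^ 2 * Complex.I_sq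
  have r3 : PowerSeries.C (2 * AA τ) = 2 * PowerSeries.C (AA τ) := by
    rw [two_mul, map_add, two_mul]
  rw [r3] at h
  simp only [Cser, dCser, Derivation.leibniz, deriv_Eser, hdX, hdC, smul_eq_mul, map_add, map_zero,
    mul_zero] at h ⊢
  linear_combination PowerSeries.C (theta τ ^ 2) * Eser (AA τ) * h
    - Eser (AA τ) * Bser p τ * r1
    - PowerSeries.C (theta τ ^ 2) * PowerSeries.X * Eser (AA τ) * Bser p τ * r2

lemma coeff_Cser (p : ℕ → Polynomial ℚ) (hp0 : p 0 = 1)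
    (hprec : ∀ n : ℕ,
      (((n : ℚ) + 1) ^ 2) • p (n + 1) + (X ^ 2 - X) * Polynomial.derivative (p n)
        - (n : ℚ) • (X * p n)
        + (1/4 : ℚ) • (X * (if n = 0 then 0 else p (n - 1))) = 0)
    (n : ℕ) : ∀ {τ : ℂ}, 0 < τ.im → PowerSeries.coeff n (Cser p τ)
      = (-(Real.pi : ℂ) ^ 2) ^ n / (n.factorial : ℂ) ^ 2 * SS n τ := by
  induction n with
  | zero =>
    intro τ hτ
    rw [Cser, PowerSeries.coeff_C_mul, PowerSeries.coeff_mul]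
    simp [coeff_Eser, Bser, bb, hp0, SS_zero hτ]
  | succ n ih =>
    intro τ hτ
    have h1 := ((hasDerivAt_SS n hτ).const_mul
      ((-(Real.pi : ℂ) ^ 2) ^ n / (n.factorial : ℂ) ^ 2)).congr_of_eventuallyEq
      ((uhp_mem_nhds hτ).mono fun w hw => ih hw)
    have h2 := (hasDerivAt_Cser p n hτ).unique h1
    have h3 := congrArg (PowerSeries.coeff n) (Cser_rec p hprec hτ)
    rw [PowerSeries.coeff_C_mul, h2, PowerSeries.coeff_derivative, PowerSeries.coeff_succ_X_mul,
      PowerSeries.coeff_derivative] at h3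
    have f1 : (n.factorial : ℂ) ≠ 0 := Nat.cast_ne_zero.2 (Nat.factorial_ne_zero n)
    have f2 : (n : ℂ) + 1 ≠ 0 := Nat.cast_add_one_ne_zero n
    rw [Nat.factorial_succ]
    push_cast
    field_simp at h3 ⊢
    rw [h3, Complex.I_sq]
    ring

/-! ## Analytic conclusion -/

/-- The double series. -/
def TT (τ w : ℂ) (q : ℕ × ℕ) : ℂ :=
  (r2 q.1 : ℂ) * ((-1 : ℂ) ^ q.2 * ((Real.pi : ℂ) ^ 2 * q.1 * w) ^ q.2
    / (Nat.factorial q.2 : ℂ) ^ 2) * Complex.exp (Real.pi * Complex.I * q.1 * τ)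

lemma summable_TT {τ : ℂ} (hτ : 0 < τ.im) (w : ℂ) : Summable fun q => ‖TT τ w q‖ := by
  have hpi := Real.pi_pos
  set δ : ℝ := Real.pi * (τ.im / 2) with hδ
  have hδ0 : 0 < δ := by positivity
  have h1 := adm_r2.2 (τ.im / 2) (by positivity)
  have h2 := Real.summable_pow_div_factorial (Real.pi ^ 2 * ‖w‖ / δ)
  have h3 := h1.mul_of_nonneg h2 (fun n => by positivity) (fun k => by positivity)
  refine Summable.of_nonneg_of_le (fun q => norm_nonneg _) (fun q => ?_) h3
  obtain ⟨n, k⟩ := q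
  have e := norm_eterm 1 (n : ℝ) τ
  simp only [one_mul, norm_one, Complex.ofReal_natCast] at e
  simp only [TT]
  rw [norm_mul, norm_mul, e, norm_div, norm_mul, norm_pow, norm_pow, norm_pow, norm_mul, norm_mul,
    norm_neg, norm_one, one_pow, one_mul, norm_pow, Complex.norm_natCast, Complex.norm_natCast,
    Complex.norm_natCast, Complex.norm_real, Real.norm_of_nonneg hpi.le]
  have e1 : (n * δ) ^ k / (k.factorial : ℝ) ≤ Real.exp (n * δ) :=
    Real.pow_div_factorial_le_exp _ (by positivity) k
  have e2 : Real.exp (-(Real.pi * n * (τ.im / 2)))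
      = Real.exp (n * δ) * Real.exp (-(Real.pi * n * τ.im)) := by
    rw [← Real.exp_add]; congr 1; rw [hδ]; ring
  rw [e2]
  have e3 : (Real.pi ^ 2 * n * ‖w‖) ^ k / (k.factorial : ℝ) ^ 2
      = (n * δ) ^ k / (k.factorial : ℝ) *
        ((Real.pi ^ 2 * ‖w‖ / δ) ^ k / (k.factorial : ℝ)) := by
    rw [div_mul_div_comm, ← mul_pow, ← sq]
    congr 2
    field_simp
  rw [e3]
  calc (r2 n : ℝ) * ((n * δ) ^ k / (k.factorial : ℝ) *
        ((Real.pi ^ 2 * ‖w‖ / δ) ^ k / (k.factorial : ℝ))) * Real.exp (-(Real.pi * n * τ.im))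
      ≤ (r2 n : ℝ) * (Real.exp (n * δ) *
        ((Real.pi ^ 2 * ‖w‖ / δ) ^ k / (k.factorial : ℝ))) * Real.exp (-(Real.pi * n * τ.im)) := by
        gcongr
    _ = _ := by ring

lemma tsum_TT_left (τ w : ℂ) (n : ℕ) : ∑' k, TT τ w (n, k)
    = (r2 n : ℂ) * j0 ((Real.pi : ℂ) ^ 2 * n * w) * Complex.exp (Real.pi * Complex.I * n * τ) := by
  rw [j0, ← tsum_mul_left, ← tsum_mul_right]
  rfl

lemma tsum_TT_right (τ w : ℂ) (k : ℕ) : ∑' n, TT τ w (n, k)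
    = (-(Real.pi : ℂ) ^ 2) ^ k / (k.factorial : ℂ) ^ 2 * SS k τ * w ^ k := by
  rw [SS, ES, ← tsum_mul_left, ← tsum_mul_right]
  congr 1; ext n
  simp only [TT, Complex.ofReal_natCast]
  rw [neg_pow, mul_pow, mul_pow]
  ring

lemma summable_left {τ : ℂ} (hτ : 0 < τ.im) (w : ℂ) :
    Summable fun n : ℕ => ‖(r2 n : ℂ) * j0 ((Real.pi : ℂ) ^ 2 * n * w) *
      Complex.exp (Real.pi * Complex.I * n * τ)‖ := by
  have h := summable_TT hτ w
  refine Summable.of_nonneg_of_le (fun n => norm_nonneg _) (fun n => ?_) h.prod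
  rw [← tsum_TT_left]
  exact norm_tsum_le_tsum_norm (h.prod_factor n)

lemma summable_right {τ : ℂ} (hτ : 0 < τ.im) (w : ℂ) :
    Summable fun k : ℕ => ‖(-(Real.pi : ℂ) ^ 2) ^ k / (k.factorial : ℂ) ^ 2 * SS k τ * w ^ k‖ := by
  have h := (Equiv.prodComm ℕ ℕ).summable_iff.2 (summable_TT hτ w)
  refine Summable.of_nonneg_of_le (fun n => norm_nonneg _) (fun n => ?_) h.prod
  rw [← tsum_TT_right]
  exact norm_tsum_le_tsum_norm (h.prod_factor n)

lemma tsum_left_eq {τ : ℂ} (hτ : 0 < τ.im) (w : ℂ) :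
    ∑' n : ℕ, (r2 n : ℂ) * j0 ((Real.pi : ℂ) ^ 2 * n * w) *
      Complex.exp (Real.pi * Complex.I * n * τ)
    = ∑' k : ℕ, (-(Real.pi : ℂ) ^ 2) ^ k / (k.factorial : ℂ) ^ 2 * SS k τ * w ^ k := by
  have h := (summable_TT hτ w).of_norm
  simp_rw [← tsum_TT_left, ← tsum_TT_right]
  exact (Summable.tsum_comm (f := fun n k => TT τ w (n, k)) h).symm

/-- For every `τ ∈ ℍ` and `z ∈ ℂ`, both series converge absolutely and
`∑_{n≥0} r₂(n) j₀(π²nz²) e^{πinτ} = θ(τ)² exp(A(τ)z²) ∑_{n≥0} π^{2n} x(τ)ⁿ pₙ(u(τ)) z^{2n}`. -/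
theorem cohen_kuznetsov_theta_expansion
    (p : ℕ → Polynomial ℚ)
    (hp0 : p 0 = 1)
    (hprec : ∀ n : ℕ,
      (((n : ℚ) + 1) ^ 2) • p (n + 1) + (X ^ 2 - X) * Polynomial.derivative (p n)
        - (n : ℚ) • (X * p n)
        + (1/4 : ℚ) • (X * (if n = 0 then 0 else p (n - 1))) = 0)
    (τ : ℂ) (hτ : 0 < τ.im) (z : ℂ) :
    Summable (fun n : ℕ => ‖(r2 n : ℂ) * j0 ((Real.pi : ℂ) ^ 2 * n * z ^ 2) *
      Complex.exp (Real.pi * Complex.I * n * τ)‖) ∧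
    Summable (fun n : ℕ => ‖(Real.pi : ℂ) ^ (2 * n) * (xx τ) ^ n *
      Polynomial.aeval (uu τ) (p n) * z ^ (2 * n)‖) ∧
    ∑' n : ℕ, (r2 n : ℂ) * j0 ((Real.pi : ℂ) ^ 2 * n * z ^ 2) *
        Complex.exp (Real.pi * Complex.I * n * τ)
      = (theta τ) ^ 2 * Complex.exp (AA τ * z ^ 2) *
        ∑' n : ℕ, (Real.pi : ℂ) ^ (2 * n) * (xx τ) ^ n *
          Polynomial.aeval (uu τ) (p n) * z ^ (2 * n) := by
  have hF : theta τ ^ 2 ≠ 0 := pow_ne_zero _ (theta_ne_zero hτ)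
  set w : ℂ := z ^ 2 with hw
  set c : ℕ → ℂ := fun k => (-(Real.pi : ℂ) ^ 2) ^ k / (k.factorial : ℂ) ^ 2 * SS k τ * w ^ k with hc
  set e : ℕ → ℂ := fun k => (-(AA τ * w)) ^ k / (k.factorial : ℂ) with he
  have hcs : Summable fun k => ‖c k‖ := summable_right hτ w
  have hes : Summable fun k => ‖e k‖ := NormedSpace.norm_expSeries_div_summable _
  have hB : Bser p τ = PowerSeries.C (theta τ ^ 2)⁻¹ * (Eser (-AA τ) * Cser p τ) := by
    have h1 := Eser_mul_neg (AA τ)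
    have h2 : PowerSeries.C (theta τ ^ 2)⁻¹ * PowerSeries.C (theta τ ^ 2) = 1 := by
      rw [← map_mul, inv_mul_cancel₀ hF, map_one]
    rw [Cser]
    linear_combination (-Bser p τ) * h2 - PowerSeries.C (theta τ ^ 2)⁻¹ *
      PowerSeries.C (theta τ ^ 2) * Bser p τ * h1
  have hb : ∀ n : ℕ, (Real.pi : ℂ) ^ (2 * n) * (xx τ) ^ n *
      Polynomial.aeval (uu τ) (p n) * z ^ (2 * n)
      = (theta τ ^ 2)⁻¹ * ∑ kl ∈ Finset.HasAntidiagonal.antidiagonal n, e kl.1 * c kl.2 := by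
    intro n
    have h1 : PowerSeries.coeff n (Bser p τ) = bb p n τ := PowerSeries.coeff_mk _ _
    rw [hB, PowerSeries.coeff_C_mul, PowerSeries.coeff_mul] at h1
    rw [← bb, ← h1, pow_mul, ← hw, mul_assoc, Finset.sum_mul]
    congr 1
    refine Finset.sum_congr rfl fun kl hkl => ?_
    rw [← Finset.HasAntidiagonal.mem_antidiagonal.1 hkl, coeff_Eser, coeff_Cser p hp0 hprec _ hτ, pow_add]
    simp only [he, hc]
    rw [neg_mul_eq_neg_mul, mul_pow]
    ring
  refine ⟨summable_left hτ w, ?_, ?_⟩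
  · simp_rw [hb, norm_mul]
    exact (summable_norm_sum_mul_antidiagonal_of_summable_norm hes hcs).mul_left _
  · simp_rw [hb]
    rw [tsum_mul_left, ← tsum_mul_tsum_eq_tsum_sum_antidiagonal_of_summable_norm hes hcs,
      tsum_left_eq hτ w]
    have hexp : ∑' k, e k = Complex.exp (-(AA τ * w)) := by
      rw [Complex.exp_eq_exp_ℂ, NormedSpace.exp_eq_tsum_div]
    rw [hexp, Complex.exp_neg]
    have := Complex.exp_ne_zero (AA τ * w)
    have h0 := theta_ne_zero hτ
    change (∑' k, c k) = _
    generalize (∑' k, c k) = S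
    field_simp
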